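/- For every integer m ≥ 1 and every real s > 0, all entries of the Crank–Nicolson matrix A_m(s) are nonnegative if and only if P_m(1 + 1/s) ≥ 0. -/

import Mathlib

open Real Matrix Filter

noncomputable section

/-- Tridiagonal 0/1 matrix with ones on the sub- and super-diagonal. -/
def triMat (m : ℕ) : Matrix (Fin m) (Fin m) ℝ :=
  fun i j => if (i : ℤ) - (j : ℤ) = 1 ∨ (j : ℤ) - (i : ℤ) = 1 then 1 else 0

/-- Crank–Nicolson iteration matrix `A_m(s)`. -/
def cnMat (m : ℕ) (s : ℝ) : Matrix (Fin m) (Fin m) ℝ :=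
  ((1 + s) • (1 : Matrix (Fin m) (Fin m) ℝ) - (s / 2) • triMat m)⁻¹ *
    ((1 - s) • (1 : Matrix (Fin m) (Fin m) ℝ) + (s / 2) • triMat m)

/-- Maximum (row-sum) norm of a square matrix: max over rows of the sum of absolute values. -/
def maxNorm {m : ℕ} (A : Matrix (Fin m) (Fin m) ℝ) : ℝ :=
  ⨆ i, ∑ j, |A i j|

/-- Chebyshev polynomials of the second kind. -/
def polyU : ℕ → Polynomial ℝ
  | 0 => 1
  | 1 => 2 * Polynomial.X
  | n + 2 => 2 * Polynomial.X * polyU (n + 1) - polyU n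

/-- Polynomials `P_n`. -/
def polyP : ℕ → Polynomial ℝ
  | 0 => -1
  | 1 => 2 * Polynomial.X - 4
  | n + 2 => 2 * Polynomial.X * polyP (n + 1) - polyP n

/-- Polynomials `C_n`. -/
def polyC : ℕ → Polynomial ℝ
  | 0 => 0
  | 1 => 4 * (Polynomial.X - 1)
  | n + 2 => 2 * Polynomial.X * polyC (n + 1) - polyC n

/-- The equation `coth(mω)·sinh(ω) = 3·cosh(ω) − 4`. -/
def cothEq (m : ℕ) (ω : ℝ) : Prop :=
  Real.cosh (m * ω) / Real.sinh (m * ω) * Real.sinh ω = 3 * Real.cosh ω - 4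

/-- The contractivity equation for odd `m`. -/
def oddEq (m : ℕ) (ω : ℝ) : Prop :=
  2 * Real.sinh (((m : ℝ) - 1) * ω / 4) * Real.sinh (((m : ℝ) + 1) * ω / 4) =
    Real.sinh (ω / 2) * Real.sinh (((m : ℝ) + 1) * ω / 2)

/-- The contractivity equation for even `m`. -/
def evenEq (m : ℕ) (ω : ℝ) : Prop :=
  Real.sinh (ω / 2) ^ 2 * Real.sinh ((m : ℝ) * ω / 2) *
      (Real.sinh (((m : ℝ) + 2) * ω / 2) - Real.sinh ((m : ℝ) * ω / 2)) =
    Real.sinh ω * Real.sinh (((m : ℝ) + 1) * ω / 2) * Real.sinh ((m : ℝ) * ω / 4) *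
      Real.sinh (((m : ℝ) - 2) * ω / 4)

/-- The Chebyshev values `U_{n-1}(x)`, shifted so that the sequence starts at `0, 1`. -/
def shiftedU (x : ℝ) : ℕ → ℝ
  | 0 => 0
  | 1 => 1
  | n + 2 => 2 * x * shiftedU x (n + 1) - shiftedU x n

lemma shiftedU_add_two (x : ℝ) (n : ℕ) :
    shiftedU x (n + 2) = 2 * x * shiftedU x (n + 1) - shiftedU x n := rfl

lemma shiftedU_nonneg_and_lt_succ {x : ℝ} (hx : 1 < x) (n : ℕ) :
    0 ≤ shiftedU x n ∧ shiftedU x n < shiftedU x (n + 1) := by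
  induction n with
  | zero => simp [shiftedU]
  | succ n ih =>
    obtain ⟨h0, h1⟩ := ih
    rw [shiftedU_add_two]
    exact ⟨by linarith, by nlinarith⟩

lemma shiftedU_nonneg {x : ℝ} (hx : 1 < x) (n : ℕ) : 0 ≤ shiftedU x n :=
  (shiftedU_nonneg_and_lt_succ hx n).1

lemma shiftedU_succ_pos {x : ℝ} (hx : 1 < x) (n : ℕ) : 0 < shiftedU x (n + 1) :=
  (shiftedU_nonneg hx n).trans_lt (shiftedU_nonneg_and_lt_succ hx n).2

/-- Addition formula for Chebyshev polynomials of the second kind. -/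
lemma shiftedU_succ_mul_succ (x : ℝ) (a b : ℕ) :
    shiftedU x (a + 1) * shiftedU x (b + 1) =
      shiftedU x (a + b + 1) + shiftedU x a * shiftedU x b := by
  induction a generalizing b with
  | zero => simp [shiftedU]
  | succ a ih =>
    have h := ih (b + 1)
    rw [← add_assoc, shiftedU_add_two] at h
    rw [shiftedU_add_two x a, show a + 1 + b + 1 = a + b + 1 + 1 by ring]
    linear_combination h

lemma eval_polyP_eq (x : ℝ) (n : ℕ) :
    (polyP n).eval x = 4 * (x - 1) * shiftedU x n - shiftedU x (n + 1) := by
  induction n using Nat.twoStepInduction with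
  | zero => simp [polyP, shiftedU]
  | one => simp [polyP, shiftedU]; ring
  | more n h0 h1 =>
    simp only [polyP, Polynomial.eval_sub, Polynomial.eval_mul, Polynomial.eval_X,
      Polynomial.eval_ofNat, h0, h1, shiftedU_add_two]
    ring

lemma sum_triMat_mul {m : ℕ} (f : ℕ → ℝ) (h0 : f 0 = 0) (hm : f (m + 1) = 0) (i : Fin m) :
    ∑ k, triMat m i k * f (k + 1) = f i + f (i + 2) := by
  have hsplit (k : Fin m) : triMat m i k * f (k + 1) =
      (if (k : ℕ) + 1 = i then f (k + 1) else 0) + if (k : ℕ) = i + 1 then f (k + 1) else 0 := by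
    unfold triMat
    split_ifs <;> first | omega | simp
  simp_rw [hsplit, Finset.sum_add_distrib]
  rw [Fin.sum_univ_eq_sum_range (fun k => if k + 1 = (i : ℕ) then f (k + 1) else 0),
    Fin.sum_univ_eq_sum_range (fun k => if k = (i : ℕ) + 1 then f (k + 1) else 0)]
  congr 1
  · obtain ⟨i, hi⟩ := i
    cases i with
    | zero => simp [h0]
    | succ i => simp [show i < m by omega]
  · rw [Finset.sum_ite_eq']
    split_ifs with h
    · rfl
    · rw [Finset.mem_range] at h
      rw [← hm]
      congr 1
      omega

/-- The (unnormalized) discrete Green function of `2x - T` on `{1, …, m}` with pole `j`. -/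
def greenFn (x : ℝ) (m j k : ℕ) : ℝ :=
  if k ≤ j then shiftedU x k * shiftedU x (m + 1 - j) else shiftedU x j * shiftedU x (m + 1 - k)

lemma greenFn_nonneg {x : ℝ} (hx : 1 < x) (m j k : ℕ) : 0 ≤ greenFn x m j k := by
  unfold greenFn
  split_ifs <;> exact mul_nonneg (shiftedU_nonneg hx _) (shiftedU_nonneg hx _)

lemma greenFn_recurrence (x : ℝ) {m i j : ℕ} (hi : i < m) (hj : j < m) :
    2 * x * greenFn x m (j + 1) (i + 1) -
      (greenFn x m (j + 1) i + greenFn x m (j + 1) (i + 2)) =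
      if i = j then shiftedU x (m + 1) else 0 := by
  unfold greenFn
  rcases lt_trichotomy i j with h | rfl | h
  · simp only [show i + 1 ≤ j + 1 by omega, show i ≤ j + 1 by omega, show i + 2 ≤ j + 1 by omega,
      h.ne, if_true, if_false, shiftedU_add_two]
    ring
  · obtain ⟨d, rfl⟩ : ∃ d, m = i + d + 1 := ⟨m - i - 1, by omega⟩
    have h := shiftedU_succ_mul_succ x (i + 1) d
    simp only [show ¬ i + 2 ≤ i + 1 by omega, le_refl, Nat.le_succ, if_true, if_false,
      show i + d + 1 + 1 - (i + 1) = d + 1 by omega, show i + d + 1 + 1 - (i + 2) = d by omega]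
    rw [shiftedU_add_two] at h
    rw [show i + d + 1 + 1 = i + 1 + d + 1 by ring]
    linear_combination h
  · obtain ⟨d, rfl⟩ : ∃ d, m = i + d + 1 := ⟨m - i - 1, by omega⟩
    have e : shiftedU x (i + d + 1 + 1 - i) = shiftedU x (d + 2) := by congr 1; omega
    have hle : (if i ≤ j + 1 then shiftedU x i * shiftedU x (i + d + 1 + 1 - (j + 1))
        else shiftedU x (j + 1) * shiftedU x (i + d + 1 + 1 - i)) =
        shiftedU x (j + 1) * shiftedU x (d + 2) := by
      split_ifs with hij
      · obtain rfl : i = j + 1 := by omega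
        rw [e]
      · rw [e]
    rw [hle]
    simp only [show ¬ i + 1 ≤ j + 1 by omega, show ¬ i + 2 ≤ j + 1 by omega, h.ne', if_false,
      show i + d + 1 + 1 - (i + 1) = d + 1 by omega, show i + d + 1 + 1 - (i + 2) = d by omega,
      shiftedU_add_two]
    ring

lemma cnMat_apply {m : ℕ} {s : ℝ} (hs : 0 < s) (i j : Fin m) :
    cnMat m s i j =
      4 / s * (greenFn (1 + 1 / s) m (j + 1) (i + 1) / shiftedU (1 + 1 / s) (m + 1)) -
        if i = j then 1 else 0 := by
  set x := 1 + 1 / s with hx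
  have hx1 : 1 < x := by rw [hx]; linarith [one_div_pos.mpr hs]
  have hU := (shiftedU_succ_pos hx1 m).ne'
  have hsx : s * x = 1 + s := by rw [hx]; field_simp; ring
  set N := (1 + s) • (1 : Matrix (Fin m) (Fin m) ℝ) - (s / 2) • triMat m with hN
  set G : Matrix (Fin m) (Fin m) ℝ := fun i j =>
    2 / s * (greenFn x m (j + 1) (i + 1) / shiftedU x (m + 1)) with hG
  have hNG : N * G = 1 := by
    ext i j
    have hsum := sum_triMat_mul (greenFn x m (j + 1)) (by simp [greenFn, shiftedU])
      (by simp [greenFn, shiftedU]) i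
    have hrec := greenFn_recurrence x i.isLt j.isLt
    have hTG : (triMat m * G) i j = 2 / s / shiftedU x (m + 1) *
        (greenFn x m (j + 1) i + greenFn x m (j + 1) (i + 2)) := by
      rw [← hsum, Matrix.mul_apply, Finset.mul_sum]
      refine Finset.sum_congr rfl fun k _ => ?_
      simp only [hG]
      ring
    rw [hN, sub_mul, smul_mul_assoc, smul_mul_assoc, one_mul, Matrix.sub_apply, Matrix.smul_apply,
      Matrix.smul_apply, hTG, ← hsx, Matrix.one_apply]
    simp only [hG, smul_eq_mul]
    have hd : (if i = j then (1 : ℝ) else 0) =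
        (if (i : ℕ) = j then shiftedU x (m + 1) else 0) / shiftedU x (m + 1) := by
      simp only [Fin.ext_iff]
      split_ifs <;> simp [hU]
    rw [hd, ← hrec]
    field_simp
  have hdet : IsUnit N.det := Matrix.isUnit_det_of_right_inverse hNG
  have hA : cnMat m s = (2 : ℝ) • G - 1 := by
    have h2 : (1 - s) • (1 : Matrix (Fin m) (Fin m) ℝ) + (s / 2) • triMat m =
        (2 : ℝ) • (1 : Matrix (Fin m) (Fin m) ℝ) - N := by
      rw [hN]
      module
    rw [cnMat, h2, ← hN, mul_sub, Matrix.nonsing_inv_mul N hdet, Matrix.inv_eq_right_inv hNG,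
      mul_smul_comm, mul_one]
  rw [hA, Matrix.sub_apply, Matrix.smul_apply, Matrix.one_apply, smul_eq_mul]
  simp only [hG]
  ring

theorem stmt18 (m : ℕ) (hm : 1 ≤ m) (s : ℝ) (hs : 0 < s) :
    (∀ i j, 0 ≤ cnMat m s i j) ↔ 0 ≤ (polyP m).eval (1 + 1 / s) := by
  have hx1 : 1 < 1 + 1 / s := by linarith [one_div_pos.mpr hs]
  have h4 : 4 * (1 + 1 / s - 1) = 4 / s := by ring
  rw [eval_polyP_eq, h4]
  simp_rw [cnMat_apply hs]
  generalize 1 + 1 / s = x at hx1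
  have hU := shiftedU_succ_pos hx1 m
  have hs4 : 0 < 4 / s := by positivity
  obtain ⟨n, rfl⟩ : ∃ n, m = n + 1 := ⟨m - 1, by omega⟩
  constructor
  · intro h
    have h00 := h 0 0
    simp only [greenFn, Fin.val_zero, le_refl, if_true, zero_add, Nat.add_sub_cancel,
      show shiftedU x 1 = 1 from rfl, one_mul] at h00
    rw [← mul_div_assoc, sub_nonneg, one_le_div hU] at h00
    linarith
  · intro h i j
    split_ifs with hij
    · subst hij
      obtain ⟨i, hi⟩ := i
      obtain ⟨d, rfl⟩ : ∃ d, n = i + d := ⟨n - i, by omega⟩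
      have hprod := shiftedU_succ_mul_succ x i d
      have hnn := mul_nonneg (shiftedU_nonneg hx1 i) (shiftedU_nonneg hx1 d)
      simp only [greenFn, le_refl, if_true, show i + d + 1 + 1 - (i + 1) = d + 1 by omega]
      rw [← mul_div_assoc, sub_nonneg, one_le_div hU, hprod]
      nlinarith [mul_nonneg hs4.le hnn]
    · rw [sub_zero]
      exact mul_nonneg hs4.le (div_nonneg (greenFn_nonneg hx1 _ _ _) hU.le)
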